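/- arXiv:1303.5450 — 3 statements merged into one kernel-verified Lean document; each statement's English description precedes it below -/
import Mathlib

section
/- Let Γ be a strictly positive definite real n×n matrix, α ∈ R, t > 0, and let S be a diagonal matrix with diagonal entries s_i ∈ [0,1). Set Q = (I + (tΓ)^{-1})^{-1}, Λ = t(I−S), and Φ₂(t,S) = (α²/2)·𝟙ᵀ(Λ(Γ^{-1}+Λ)^{-1}Λ − Λ)𝟙, where 𝟙 = (1,...,1)ᵀ. Then Φ₂(t,S) = (α² t/2)·𝟙ᵀ[(Q − I) + (I − Q^{-1})(Σ_{m=1}^∞ (QS)^m)(Q − I)]𝟙. -/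
open Matrix

section aux
open scoped Matrix.Norms.L2Operator

theorem aux_norm {n : ℕ} (A Q : Matrix (Fin n) (Fin n) ℝ) (hA : A.PosSemidef)
    (h : (1 + A) * Q = 1) : ‖Q‖ ≤ 1 := by
  rw [Matrix.l2_opNorm_def]
  refine ContinuousLinearMap.opNorm_le_bound _ zero_le_one fun x => ?_
  rw [one_mul]
  refine le_of_sq_le_sq ?_ (norm_nonneg _)
  rw [EuclideanSpace.real_norm_sq_eq, EuclideanSpace.real_norm_sq_eq]
  have e : x.ofLp = Q *ᵥ x.ofLp + A *ᵥ (Q *ᵥ x.ofLp) := by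
    conv_lhs => rw [← Matrix.one_mulVec x.ofLp, ← h, ← Matrix.mulVec_mulVec, Matrix.add_mulVec,
      Matrix.one_mulVec]
  have hp := hA.dotProduct_mulVec_nonneg (Q *ᵥ x.ofLp)
  simp only [star_trivial, dotProduct] at hp
  change ∑ i, ((Q *ᵥ x.ofLp) i) ^ 2 ≤ ∑ i, (x.ofLp i) ^ 2
  have e2 : ∑ i, (x.ofLp i) ^ 2 = ∑ i, ((Q *ᵥ x.ofLp) i) ^ 2
      + 2 * ∑ i, (Q *ᵥ x.ofLp) i * (A *ᵥ (Q *ᵥ x.ofLp)) i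
      + ∑ i, ((A *ᵥ (Q *ᵥ x.ofLp)) i) ^ 2 := by
    rw [Finset.mul_sum, ← Finset.sum_add_distrib, ← Finset.sum_add_distrib]
    refine Finset.sum_congr rfl fun i _ => ?_
    have := congrFun e i
    rw [Pi.add_apply] at this
    rw [this]
    ring
  have h3 : 0 ≤ ∑ i, ((A *ᵥ (Q *ᵥ x.ofLp)) i) ^ 2 := Finset.sum_nonneg fun i _ => sq_nonneg _
  linarith

theorem aux_tsum {n : ℕ} (A Q : Matrix (Fin n) (Fin n) ℝ) (hA : A.PosSemidef)
    (h : (1 + A) * Q = 1) (s : Fin n → ℝ) (hs : ∀ i, s i ∈ Set.Ico (0 : ℝ) 1) :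
    (1 + ∑' m : ℕ, (Q * Matrix.diagonal s) ^ (m + 1)) * (1 - Q * Matrix.diagonal s) = 1 := by
  have h1 : ‖Q * Matrix.diagonal s‖ < 1 := by
    have hd : ‖(Matrix.diagonal s : Matrix (Fin n) (Fin n) ℝ)‖ < 1 := by
      rw [Matrix.l2_opNorm_diagonal, pi_norm_lt_iff one_pos]
      intro i
      rw [Real.norm_eq_abs, abs_of_nonneg (hs i).1]
      exact (hs i).2
    calc _ ≤ ‖Q‖ * ‖(Matrix.diagonal s : Matrix (Fin n) (Fin n) ℝ)‖ := Matrix.l2_opNorm_mul _ _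
      _ ≤ 1 * ‖(Matrix.diagonal s : Matrix (Fin n) (Fin n) ℝ)‖ := by
        gcongr; exact aux_norm A Q hA h
      _ < 1 := by rwa [one_mul]
  have hsum := summable_geometric_of_norm_lt_one h1
  have := geom_series_mul_neg (Q * Matrix.diagonal s) h1
  rw [hsum.tsum_eq_zero_add, pow_zero] at this
  exact this

end aux

theorem stmt_3 {n : ℕ} (Γ : Matrix (Fin n) (Fin n) ℝ) (hΓ : Γ.PosDef) (α : ℝ)
    (t : ℝ) (ht : 0 < t) (s : Fin n → ℝ) (hs : ∀ i, s i ∈ Set.Ico (0 : ℝ) 1)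
    (S Q Λ : Matrix (Fin n) (Fin n) ℝ)
    (hS : S = Matrix.diagonal s)
    (hQ : Q = (1 + (t • Γ)⁻¹)⁻¹)
    (hΛ : Λ = t • (1 - S)) :
    α ^ 2 / 2 * ∑ i, ∑ j, (Λ * (Γ⁻¹ + Λ)⁻¹ * Λ - Λ) i j =
      α ^ 2 * t / 2 *
        ∑ i, ∑ j, ((Q - 1) + (1 - Q⁻¹) * (∑' m : ℕ, (Q * S) ^ (m + 1)) * (Q - 1)) i j := by
  have hA : ((t • Γ)⁻¹).PosDef := (hΓ.smul ht).inv
  have hGA : Γ⁻¹ = t • (t • Γ)⁻¹ := by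
    have hu : IsUnit Γ.det := (Matrix.isUnit_iff_isUnit_det _).1 hΓ.isUnit
    have : (t • Γ)⁻¹ = t⁻¹ • Γ⁻¹ := by
      apply Matrix.inv_eq_left_inv
      rw [smul_mul_smul_comm, Matrix.nonsing_inv_mul _ hu, inv_mul_cancel₀ ht.ne', one_smul]
    rw [this, smul_smul, mul_inv_cancel₀ ht.ne', one_smul]
  generalize (t • Γ)⁻¹ = A at *
  have hP : (1 + A).PosDef := Matrix.PosDef.one.add hA
  have hu : IsUnit (1 + A).det := (Matrix.isUnit_iff_isUnit_det _).1 hP.isUnit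
  have hPQ : (1 + A) * Q = 1 := by rw [hQ, Matrix.mul_nonsing_inv _ hu]
  have hQP : Q * (1 + A) = 1 := by rw [hQ, Matrix.nonsing_inv_mul _ hu]
  have hQi : Q⁻¹ = 1 + A := Matrix.inv_eq_left_inv hPQ
  have hT := aux_tsum A Q hA.posSemidef hPQ s hs
  rw [← hS] at hT
  rw [hQi]
  generalize (∑' m : ℕ, (Q * S) ^ (m + 1)) = T at *
  obtain ⟨R, hR⟩ : ∃ R, R = (1 + T) * Q := ⟨_, rfl⟩
  have hRP : R * (1 + A - S) = 1 := by
    rw [hR, mul_assoc, mul_sub Q, hQP, hT]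
  have hPR : (1 + A - S) * R = 1 := mul_eq_one_comm.1 hRP
  have hTR : T = R * (1 + A) - 1 := by
    rw [hR, mul_assoc, hQP]; simp
  have hinv : (Γ⁻¹ + Λ)⁻¹ = t⁻¹ • R := by
    apply Matrix.inv_eq_left_inv
    have : Γ⁻¹ + Λ = t • (1 + A - S) := by
      rw [hGA, hΛ, ← smul_add]; congr 1; abel
    rw [this, smul_mul_smul_comm, hRP, inv_mul_cancel₀ ht.ne', one_smul]
  have key : Λ * (Γ⁻¹ + Λ)⁻¹ * Λ - Λ = t • ((Q - 1) + (1 - (1 + A)) * T * (Q - 1)) := by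
    have k1 : (1 - S) * R * (1 - S) - (1 - S) = A * R * A - A := by
      have e : 1 - S = (1 + A - S) - A := by abel
      rw [e, sub_mul _ A R, hPR, sub_mul, one_mul, mul_sub, mul_assoc A R (1 + A - S), hRP]
      noncomm_ring
    have k2 : (Q - 1) + (1 - (1 + A)) * T * (Q - 1) = A * R * A - A := by
      have e1 : (1 + A) * (Q - 1) = -A := by rw [mul_sub, hPQ]; noncomm_ring
      have e2 : T * (Q - 1) = - (R * A) - (Q - 1) := by
        rw [hTR, sub_mul, mul_assoc, e1]; noncomm_ring
      have e3 : A * Q = 1 - Q := by rw [← hPQ]; noncomm_ring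
      rw [mul_assoc, e2]
      have : (1 - (1 + A)) * (-(R * A) - (Q - 1)) = A * R * A + A * Q - A := by noncomm_ring
      rw [this, e3]; abel
    rw [hinv, k2, ← k1, hΛ, smul_mul_smul_comm, mul_inv_cancel₀ ht.ne', one_smul, mul_smul_comm,
      ← smul_sub]
  rw [key]
  simp only [Matrix.smul_apply, smul_eq_mul, ← Finset.mul_sum]
  ring
end

section
/- Let Q and S be real n×n matrices with Q invertible and with the spectral radius of QS strictly less than 1 (so that I − QS is invertible and Σ_{m=0}^∞ (QS)^m = (I − QS)^{-1}). Then (I − S)(I − QS)^{-1}Q(I − S) + (S − I) = (Q − I) + (I − Q^{-1})(Σ_{m=1}^∞ (QS)^m)(Q − I). -/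
open Matrix

theorem aux_summable_norm_pow {A : Type*} [NormedRing A] [NormedAlgebra ℂ A] [CompleteSpace A]
    (a : A) (h : spectralRadius ℂ a < 1) : Summable (fun m : ℕ => ‖a ^ m‖) := by
  obtain ⟨r, hr1, hr2⟩ := ENNReal.lt_iff_exists_nnreal_btwn.1 h
  have hr : r < 1 := by exact_mod_cast hr2
  have ht := spectrum.pow_nnnorm_pow_one_div_tendsto_nhds_spectralRadius a
  have hev := ht.eventually (gt_mem_nhds hr1)
  refine Summable.of_norm_bounded_eventually_nat (g := fun m : ℕ => (r : ℝ) ^ m)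
    (summable_geometric_of_lt_one r.2 (by exact_mod_cast hr)) ?_
  filter_upwards [hev, Filter.eventually_gt_atTop 0] with m hm hm0
  have hm' : (0 : ℝ) < m := by exact_mod_cast hm0
  rw [norm_norm]
  have h1 := ENNReal.rpow_le_rpow hm.le hm'.le
  rw [← ENNReal.rpow_mul, one_div, inv_mul_cancel₀ hm'.ne', ENNReal.rpow_one,
    ENNReal.rpow_natCast] at h1
  have h2 : ‖a ^ m‖₊ ≤ r ^ m := by exact_mod_cast h1
  exact_mod_cast h2

section
attribute [local instance] Matrix.linftyOpNormedRing Matrix.linftyOpNormedAlgebra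

theorem aux_entry_summable {n : ℕ} (M : Matrix (Fin n) (Fin n) ℂ)
    (h : ∀ z ∈ spectrum ℂ M, ‖z‖ < 1) (i j : Fin n) :
    Summable (fun m : ℕ => ‖(M ^ m) i j‖) := by
  haveI : Nonempty (Fin n) := ⟨i⟩
  have hs : spectralRadius ℂ M < 1 := by
    have := spectrum.spectralRadius_lt_of_forall_lt (a := M) (r := 1)
      (fun z hz => by exact_mod_cast h z hz)
    exact_mod_cast this
  refine Summable.of_nonneg_of_le (fun _ => norm_nonneg _) (fun m => ?_)
    (aux_summable_norm_pow M hs)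
  have h1 : ‖(M ^ m) i j‖₊ ≤ ‖M ^ m‖₊ := by
    rw [Matrix.linfty_opNNNorm_def]
    exact (Finset.single_le_sum (f := fun j => ‖(M ^ m) i j‖₊) (fun _ _ => zero_le)
      (Finset.mem_univ j)).trans
      (Finset.le_sup (f := fun i => ∑ j, ‖(M ^ m) i j‖₊) (Finset.mem_univ i))
  exact_mod_cast h1

end

theorem aux_summable {n : ℕ} (A : Matrix (Fin n) (Fin n) ℝ)
    (h : ∀ z ∈ spectrum ℂ (A.map (algebraMap ℝ ℂ)), ‖z‖ < 1) :
    Summable (fun m : ℕ => A ^ m) := by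
  refine Pi.summable.2 fun i => Pi.summable.2 fun j => ?_
  refine Summable.of_norm ((aux_entry_summable _ h i j).congr fun m => ?_)
  rw [← Matrix.map_pow]
  simp

/-- key algebraic identity in Lemma 2.1: if `Q` is invertible and the spectral
radius of `QS` is `< 1` (all complex eigenvalues of `QS` have modulus `< 1`), then
`(I−S)(I−QS)⁻¹Q(I−S) + (S−I) = (Q−I) + (I−Q⁻¹)(Σ_{m≥1}(QS)^m)(Q−I)`. -/
theorem stmt_4 {n : ℕ} (Q S : Matrix (Fin n) (Fin n) ℝ) (hQ : IsUnit Q)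
    (hspec : ∀ z ∈ spectrum ℂ ((Q * S).map (algebraMap ℝ ℂ)), ‖z‖ < 1) :
    (1 - S) * (1 - Q * S)⁻¹ * Q * (1 - S) + (S - 1) =
      (Q - 1) + (1 - Q⁻¹) * (∑' m : ℕ, (Q * S) ^ (m + 1)) * (Q - 1) := by
  have hsum := aux_summable (Q * S) hspec
  have hdet : IsUnit Q.det := (Matrix.isUnit_iff_isUnit_det Q).1 hQ
  have hq1 : Q * Q⁻¹ = 1 := Matrix.mul_nonsing_inv Q hdet
  have hq2 : Q⁻¹ * Q = 1 := Matrix.nonsing_inv_mul Q hdet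
  have hS : S = Q⁻¹ * (Q * S) := by rw [← mul_assoc, hq2, one_mul]
  generalize hA : Q * S = A at *
  generalize Q⁻¹ = P at *
  have h0 := hsum.tsum_eq_zero_add
  have h1 : ∑' m : ℕ, A ^ (m + 1) = A * ∑' m : ℕ, A ^ m := by
    rw [← hsum.tsum_mul_left]
    simp only [pow_succ']
  have hR : (1 - A)⁻¹ = ∑' m : ℕ, A ^ m := by
    apply Matrix.inv_eq_right_inv
    rw [sub_mul, one_mul, ← h1, h0]
    simp
  have hT : ∑' m : ℕ, A ^ (m + 1) = (1 - A)⁻¹ - 1 := by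
    rw [hR, h0]; simp
  have hAR : A * (1 - A)⁻¹ = (1 - A)⁻¹ - 1 := by rw [← hT, h1, hR]
  have hU : (1 - A)⁻¹ * (1 - A) = 1 := by
    have : (1 - A) * (1 - A)⁻¹ = 1 := by rw [sub_mul, hAR]; simp
    exact mul_eq_one_comm.1 this
  rw [hT]
  generalize (1 - A)⁻¹ = R at *
  have e1 : (1 - S) * R = (1 - P) * R + P := by
    rw [hS, sub_mul, mul_assoc, hAR]; noncomm_ring
  have e2 : Q * (1 - S) = (Q - 1) + (1 - A) := by
    rw [mul_sub, hA]; noncomm_ring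
  have e3 : (1 - P) * R * (1 - A) = 1 - P := by rw [mul_assoc, hU, mul_one]
  have e4 : (1 - P) * (Q - 1) = Q - 1 - 1 + P := by
    rw [mul_sub, sub_mul, hq2]; noncomm_ring
  have e5 : P * (Q - 1 + (1 - A)) = 1 - S := by
    rw [← e2, ← mul_assoc, hq2, one_mul]
  rw [mul_assoc, e2, e1, add_mul, e5, mul_add, e3, mul_sub (1 - P) R 1, mul_one,
    sub_mul _ _ (Q - 1), e4]
  abel
end

section
/- Let A be a real symmetric n×n matrix with A_{i,j} ≤ 0 for all i ≠ j. Fix indices i ≠ j and an integer k ≥ 1 such that (A^u)_{i,j} = 0 for all integers u with 1 ≤ u < k. Then (−1)^k (A^k)_{i,j} ≥ 0; that is, every nonvanishing term in the expansion of (A^k)_{i,j} is a product of k off-diagonal entries of A and has sign (−1)^k, so no cancellation occurs. -/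
open Matrix

/-- sign claim in the proof of Lemma `sign`: let `A` be real symmetric with
nonpositive off-diagonal entries, `i ≠ j`, and `k ≥ 1` with `(A^u) i j = 0` for all
`1 ≤ u < k`. Then `(−1)^k (A^k) i j ≥ 0`. -/
theorem stmt_7 {n : ℕ} (A : Matrix (Fin n) (Fin n) ℝ) (hsymm : A.IsSymm)
    (hoff : ∀ i j, i ≠ j → A i j ≤ 0)
    (i j : Fin n) (hij : i ≠ j) (k : ℕ) (hk : 1 ≤ k)
    (hvanish : ∀ u : ℕ, 1 ≤ u → u < k → (A ^ u) i j = 0) :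
    0 ≤ (-1 : ℝ) ^ k * (A ^ k) i j := by
  obtain ⟨c, hc⟩ : ∃ c : ℝ, ∀ l, A l l ≤ c := by
    refine ⟨∑ l, |A l l|, fun l => (le_abs_self _).trans ?_⟩
    exact Finset.single_le_sum (f := fun l => |A l l|) (fun _ _ => abs_nonneg _)
      (Finset.mem_univ l)
  have hpos : ∀ (m : ℕ) (a b : Fin n),
      0 ≤ (((-1 : ℝ) • A + c • (1 : Matrix (Fin n) (Fin n) ℝ)) ^ m) a b := by
    intro m
    induction m with
    | zero =>
      intro a b
      rw [pow_zero, Matrix.one_apply]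
      split_ifs <;> norm_num
    | succ m ih =>
      intro a b
      rw [pow_succ, Matrix.mul_apply]
      refine Finset.sum_nonneg fun l _ => mul_nonneg (ih a l) ?_
      by_cases h : l = b
      · subst h
        simpa using hc l
      · simpa [Matrix.one_apply, h] using hoff l b h
  have key := hpos k i j
  have hcomm : Commute ((-1 : ℝ) • A) (c • (1 : Matrix (Fin n) (Fin n) ℝ)) :=
    (Commute.one_right _).smul_right c
  rw [hcomm.add_pow, Matrix.sum_apply, Finset.sum_range_succ, Finset.sum_eq_zero] at key
  · rw [smul_pow (-1 : ℝ) A k] at key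
    simpa using key
  · intro u hu
    have hu' : u < k := Finset.mem_range.mp hu
    have h0 : (A ^ u) i j = 0 := by
      rcases Nat.eq_zero_or_pos u with h | h
      · subst h
        simp [hij]
      · exact hvanish u h hu'
    rw [smul_pow, smul_pow, one_pow, ← nsmul_eq_mul']
    simp [h0]
end
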